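/- (Unbiasedness of the second orthogonal score at the truth) Under the noise conditions E[ξ | σ(D,Z)] = 0 a.s. and E[ν | σ(Z)] = 0 a.s., with ξ integrable, ν bounded, and E[ν² | σ(Z)] ≥ c > 0 almost surely for some constant c, one has E[(Y − g0(D, Z)) · (D − m0(Z))² / E[ν² | σ(Z)]] = 0. Consequently, for each i ∈ {0,1}, the potential outcome Y(i) := g0(i, Z) + ξ satisfies E[g0(i, Z) + (Y(i) − g0(i, Z)) · ((D − m0(Z)) − E[ν | σ(Z)])² / E[ν² | σ(Z)]] = E[g0(i, Z)] = θ0^i, i.e., E[ψ2(W, θ0^i, ρ0)] = 0. -/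

import Mathlib

open MeasureTheory ProbabilityTheory

/-- A function with vanishing conditional expectation given `m` is orthogonal to every bounded
`m`-measurable function. -/
theorem integral_mul_eq_zero_of_condExp_eq_zero {Ω : Type*} {m mΩ : MeasurableSpace Ω}
    {μ : Measure Ω} [IsFiniteMeasure μ] (hm : m ≤ mΩ) {f w : Ω → ℝ}
    (hf : Integrable f μ) (hw : StronglyMeasurable[m] w) {K : ℝ} (hK : ∀ᵐ ω ∂μ, ‖w ω‖ ≤ K)
    (h : μ[f | m] =ᵐ[μ] 0) : ∫ ω, w ω * f ω ∂μ = 0 := by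
  have hpull : μ[w * f | m] =ᵐ[μ] 0 := by
    filter_upwards [condExp_stronglyMeasurable_mul_of_bound hm hw hf K hK, h] with ω h₁ h₂
    simp [h₁, h₂]
  calc ∫ ω, w ω * f ω ∂μ = ∫ ω, (μ[w * f | m]) ω ∂μ := (integral_condExp hm).symm
    _ = 0 := integral_eq_zero_of_ae hpull

/-- Unbiasedness of the second orthogonal score at the truth: Under the noise
conditions, with `ξ` integrable, `ν` bounded and `E[ν² | σ(Z)] ≥ c > 0` a.s.,
`E[(Y − g0(D, Z)) · (D − m0(Z))² / E[ν² | σ(Z)]] = 0`, and consequently for each `i ∈ {0,1}`,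
the potential outcome `Y(i) := g0(i, Z) + ξ` satisfies
`E[g0(i, Z) + (Y(i) − g0(i, Z)) · ((D − m0(Z)) − E[ν | σ(Z)])² / E[ν² | σ(Z)]] = E[g0(i, Z)]`. -/
theorem stmt_10
    {Ω : Type*} [MeasurableSpace Ω] (P : Measure Ω) [IsProbabilityMeasure P]
    {E : Type*} [MeasurableSpace E]
    (Z : Ω → E) (hZ : Measurable Z)
    (D : Ω → ℝ) (hD : Measurable D) (hD01 : ∀ᵐ ω ∂P, D ω = 0 ∨ D ω = 1)
    (Y : Ω → ℝ) (hY : Integrable Y P)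
    (g0 : ℝ × E → ℝ) (hg0 : Measurable g0)
    (m0 : E → ℝ) (hm0 : Measurable m0)
    (hg0int : Integrable (fun ω => g0 (D ω, Z ω)) P)
    (hg0zint : Integrable (fun ω => g0 (0, Z ω)) P)
    (hg1int : Integrable (fun ω => g0 (1, Z ω)) P)
    (hm0int : Integrable (fun ω => m0 (Z ω)) P)
    (hm0bdd : ∃ C : ℝ, ∀ᵐ ω ∂P, |m0 (Z ω)| ≤ C)
    (hnubdd : ∃ C : ℝ, ∀ᵐ ω ∂P, |D ω - m0 (Z ω)| ≤ C)
    (hxiint : Integrable (fun ω => Y ω - g0 (D ω, Z ω)) P)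
    (hxi : P[fun ω => Y ω - g0 (D ω, Z ω) |
        MeasurableSpace.comap (fun ω => (D ω, Z ω)) inferInstance] =ᵐ[P] 0)
    (hnu : P[fun ω => D ω - m0 (Z ω) | MeasurableSpace.comap Z inferInstance] =ᵐ[P] 0)
    (c : ℝ) (hc : 0 < c)
    (hcge : ∀ᵐ ω ∂P,
      c ≤ (P[fun ω' => (D ω' - m0 (Z ω')) ^ 2 | MeasurableSpace.comap Z inferInstance]) ω) :
    (∫ ω, (Y ω - g0 (D ω, Z ω)) * (D ω - m0 (Z ω)) ^ 2 /
        (P[fun ω' => (D ω' - m0 (Z ω')) ^ 2 | MeasurableSpace.comap Z inferInstance]) ω ∂P = 0) ∧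
    ∀ i : ℝ, (i = 0 ∨ i = 1) →
      ∫ ω, (g0 (i, Z ω) +
          ((g0 (i, Z ω) + (Y ω - g0 (D ω, Z ω))) - g0 (i, Z ω)) *
            ((D ω - m0 (Z ω)) -
              (P[fun ω' => D ω' - m0 (Z ω') | MeasurableSpace.comap Z inferInstance]) ω) ^ 2 /
            (P[fun ω' => (D ω' - m0 (Z ω')) ^ 2 | MeasurableSpace.comap Z inferInstance]) ω) ∂P =
        ∫ ω, g0 (i, Z ω) ∂P := by
  obtain ⟨C, hC⟩ := hnubdd
  set ξ : Ω → ℝ := fun ω => Y ω - g0 (D ω, Z ω) with hξ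
  set V : Ω → ℝ :=
    P[fun ω' => (D ω' - m0 (Z ω')) ^ 2 | MeasurableSpace.comap Z inferInstance]
  set w : Ω → ℝ := fun ω => (D ω - m0 (Z ω)) ^ 2 / V ω with hw
  have hle := (hD.prodMk hZ).comap_le
  let mDZ : MeasurableSpace Ω := MeasurableSpace.comap (fun ω => (D ω, Z ω)) inferInstance
  have hDZ : Measurable[mDZ] (fun ω => (D ω, Z ω)) := comap_measurable _
  have hDm : Measurable[mDZ] D := measurable_fst.comp hDZ
  have hZm : Measurable[mDZ] Z := measurable_snd.comp hDZ
  have hVm : Measurable[mDZ] V :=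
    (stronglyMeasurable_condExp.mono hZm.comap_le).measurable
  have hwm : StronglyMeasurable[mDZ] w :=
    (((hDm.sub (hm0.comp hZm)).pow_const 2).div hVm).stronglyMeasurable
  have hwb : ∀ᵐ ω ∂P, ‖w ω‖ ≤ C ^ 2 / c := by
    filter_upwards [hC, hcge] with ω h₁ h₂
    have hVpos : 0 < V ω := hc.trans_le h₂
    rw [Real.norm_of_nonneg (by positivity)]
    exact div_le_div₀ (sq_nonneg C) (sq_le_sq' (abs_le.mp h₁).1 (abs_le.mp h₁).2) hc h₂
  have hzero : ∫ ω, w ω * ξ ω ∂P = 0 :=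
    integral_mul_eq_zero_of_condExp_eq_zero hle hxiint hwm hwb hxi
  have hint : Integrable (fun ω => w ω * ξ ω) P :=
    hxiint.bdd_mul (hwm.mono hle).aestronglyMeasurable hwb
  refine ⟨?_, fun i hi => ?_⟩
  · rw [← hzero]
    congr 1 with ω
    simp only [hw, hξ]
    ring
  · have hgi : Integrable (fun ω => g0 (i, Z ω)) P := by
      rcases hi with rfl | rfl <;> assumption
    calc _ = ∫ ω, (g0 (i, Z ω) + w ω * ξ ω) ∂P := by
          refine integral_congr_ae ?_
          filter_upwards [hnu] with ω h
          simp only [h, Pi.zero_apply, hw, hξ]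
          ring
      _ = ∫ ω, g0 (i, Z ω) ∂P := by rw [integral_add hgi hint, hzero, add_zero]
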